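/- Let f:U→ℝ^n be a C² map of the Monge form on an open set U⊂ℝ^d with n=d+m and with first and second partial derivatives bounded on U, and let θ∈ℝ^n. Let B⊂U be a ball. Then there is a constant C>0 depending on n and f such that for all sufficiently large t>0, every ε∈(0,1) and every x_0 ∈ B ∩ (U ∖ 𝔐(ε,t)): N_θ(Δ_t(x_0) ∩ B; ε, t) ≤ C·ε^n e^t (ε e^{−t})^{−d/2}, where Δ_t(x_0) := B[x_0,(ε/e^t)^{1/2}] is the closed sup-norm ball. -/

import Mathlib

open MeasureTheory Filter Set
open scoped ENNReal NNReal

noncomputable section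

/-- The set `S_n^θ(ψ)` of `(ψ,θ)`-approximable points of `ℝ^n` (sup norm on `Fin n → ℝ`):
points `x` with `‖x - (p+θ)/q‖ ≤ ψ q / q` for infinitely many `(p,q) ∈ ℤ^n × ℕ`. -/
def SApprox (n : ℕ) (θ : Fin n → ℝ) (ψ : ℝ → ℝ) : Set (Fin n → ℝ) :=
  {x | {pq : (Fin n → ℤ) × ℕ | 0 < pq.2 ∧
    ‖(fun i => x i - ((pq.1 i : ℝ) + θ i) / (pq.2 : ℝ) : Fin n → ℝ)‖ ≤
      ψ (pq.2 : ℝ) / (pq.2 : ℝ)}.Infinite}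

/-- Iterated partial derivatives along a list of coordinate directions. -/
def listPDeriv {d n : ℕ} : List (Fin d) → ((Fin d → ℝ) → (Fin n → ℝ)) → ((Fin d → ℝ) → (Fin n → ℝ))
  | [], f => f
  | i :: is, f => fun x => fderiv ℝ (listPDeriv is f) x (Pi.single i 1)

/-- `f` is `l`-nondegenerate at `x`: `f` is `C^l` near `x` and the partial derivatives of `f`
at `x` of orders `1,…,l` span `ℝ^n`. -/
def IsLNondegenerateAt {d n : ℕ} (l : ℕ) (f : (Fin d → ℝ) → (Fin n → ℝ)) (x : Fin d → ℝ) : Prop :=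
  (∃ V ∈ nhds x, ContDiffOn ℝ l f V) ∧
  Submodule.span ℝ {v : Fin n → ℝ | ∃ β : List (Fin d),
    1 ≤ β.length ∧ β.length ≤ l ∧ v = listPDeriv β f x} = ⊤

def IsNondegenerateAt {d n : ℕ} (f : (Fin d → ℝ) → (Fin n → ℝ)) (x : Fin d → ℝ) : Prop :=
  ∃ l : ℕ, IsLNondegenerateAt l f x

/-- `f` is nondegenerate in `U`: nondegenerate at almost every point of `U`. -/
def IsNondegenerateIn {d n : ℕ} (f : (Fin d → ℝ) → (Fin n → ℝ)) (U : Set (Fin d → ℝ)) : Prop :=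
  ∀ᵐ x ∂(volume : Measure (Fin d → ℝ)), x ∈ U → IsNondegenerateAt f x

/-- `f` is nonsingular on `U`: its Jacobian has rank `d` at every point of `U`. -/
def IsNonsingularOn {d n : ℕ} (f : (Fin d → ℝ) → (Fin n → ℝ)) (U : Set (Fin d → ℝ)) : Prop :=
  ∀ x ∈ U, LinearMap.rank (fderiv ℝ f x).toLinearMap = (d : Cardinal)

/-- `η(n,d)`. -/
def etaND (n d : ℕ) : ℝ := if 1 < d then 1 / ((n : ℝ) - 1) else 3 / (2 * (n : ℝ) - 1)

/-- The set counted by `N*_θ(Δ;ε,t)`. -/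
def NstarSet {d n : ℕ} (f : (Fin d → ℝ) → Fin n → ℝ) (θ : Fin n → ℝ)
    (Δ : Set (Fin d → ℝ)) (ε t : ℝ) : Set ((Fin n → ℤ) × ℤ) :=
  {pq | Real.exp (t - 1) ≤ (pq.2 : ℝ) ∧ (pq.2 : ℝ) ≤ Real.exp t ∧
    sInf ((fun x => ‖(fun i => f x i - ((pq.1 i : ℝ) + θ i) / (pq.2 : ℝ) : Fin n → ℝ)‖) '' Δ)
      ≤ ε / Real.exp t}

/-- `N*_θ(Δ;ε,t)`. -/
def Nstar {d n : ℕ} (f : (Fin d → ℝ) → Fin n → ℝ) (θ : Fin n → ℝ)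
    (Δ : Set (Fin d → ℝ)) (ε t : ℝ) : ℕ := (NstarSet f θ Δ ε t).ncard

/-- The set counted by `N_θ(Δ;ε,t)` (with `1 ≤ q ≤ e^t`). -/
def NfullSet {d n : ℕ} (f : (Fin d → ℝ) → Fin n → ℝ) (θ : Fin n → ℝ)
    (Δ : Set (Fin d → ℝ)) (ε t : ℝ) : Set ((Fin n → ℤ) × ℤ) :=
  {pq | 1 ≤ pq.2 ∧ (pq.2 : ℝ) ≤ Real.exp t ∧
    sInf ((fun x => ‖(fun i => f x i - ((pq.1 i : ℝ) + θ i) / (pq.2 : ℝ) : Fin n → ℝ)‖) '' Δ)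
      ≤ ε / Real.exp t}

/-- `N_θ(Δ;ε,t)`. -/
def Nfull {d n : ℕ} (f : (Fin d → ℝ) → Fin n → ℝ) (θ : Fin n → ℝ)
    (Δ : Set (Fin d → ℝ)) (ε t : ℝ) : ℕ := (NfullSet f θ Δ ε t).ncard

/-- Sup norm of the gradient of a scalar function on `ℝ^d`. -/
def gradSupNorm {d : ℕ} (g : (Fin d → ℝ) → ℝ) (x : Fin d → ℝ) : ℝ :=
  ‖(fun j : Fin d => fderiv ℝ g x (Pi.single j 1) : Fin d → ℝ)‖

/-- The set `𝔖_f(δ,K,T)`. -/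
def SfrakSet {d n : ℕ} (U : Set (Fin d → ℝ)) (f : (Fin d → ℝ) → Fin n → ℝ)
    (δ K : ℝ) (T : Fin n → ℝ) : Set (Fin d → ℝ) :=
  {x | x ∈ U ∧ ∃ a₀ : ℤ, ∃ a : Fin n → ℤ, a ≠ 0 ∧
    |(a₀ : ℝ) + ∑ i, f x i * (a i : ℝ)| < δ ∧
    gradSupNorm (fun y => ∑ i, f y i * (a i : ℝ)) x < K ∧
    ∀ i, |(a i : ℝ)| < T i}

/-- First-order partial derivative `∂_i f_j` (0-based indices as naturals; junk value 0
out of range). -/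
def pd1 {d m : ℕ} (f : (Fin d → ℝ) → Fin m → ℝ) (i j : ℕ) (x : Fin d → ℝ) : ℝ :=
  if h : i < d ∧ j < m then
    fderiv ℝ (fun y => f y ⟨j, h.2⟩) x (Pi.single (⟨i, h.1⟩ : Fin d) 1)
  else 0

/-- Second-order partial derivative `∂_{i'} ∂_i f_j`. -/
def pd2 {d m : ℕ} (f : (Fin d → ℝ) → Fin m → ℝ) (i i' j : ℕ) (x : Fin d → ℝ) : ℝ :=
  if h : i' < d then fderiv ℝ (fun y => pd1 f i j y) x (Pi.single (⟨i', h⟩ : Fin d) 1) else 0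

/-- The Monge map `x ↦ (x, f(x)) : ℝ^d → ℝ^{d+m}`. -/
def fullMap (d m : ℕ) (f : (Fin d → ℝ) → Fin m → ℝ) : (Fin d → ℝ) → Fin (d + m) → ℝ :=
  fun x i => if h : (i : ℕ) < d then x ⟨(i : ℕ), h⟩
    else f x ⟨(i : ℕ) - d, by have := i.isLt; omega⟩

/-- The `i`-th Minkowski successive minimum (w.r.t. the closed unit Euclidean ball) of the
lattice `g ℤ^k`. -/
def succMin {k : ℕ} (i : ℕ) (g : Matrix (Fin k) (Fin k) ℝ) : ℝ :=
  sInf {r : ℝ | 0 ≤ r ∧ i ≤ Module.finrank ℝ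
    (Submodule.span ℝ {w : Fin k → ℝ | (∃ v : Fin k → ℤ, v ≠ 0 ∧
      w = g.mulVec (fun j => (v j : ℝ))) ∧ Real.sqrt (∑ j, w j ^ 2) ≤ r})}

/-- The unipotent matrix `u₁(x) ∈ SL_{n+1}(ℝ)`, `n = d+m`. -/
def u1Mat {d m : ℕ} (f : (Fin d → ℝ) → Fin m → ℝ) (x : Fin d → ℝ) :
    Matrix (Fin (d + m + 1)) (Fin (d + m + 1)) ℝ := fun r c =>
  if (r : ℕ) = (c : ℕ) then 1
  else if (r : ℕ) < m ∧ m ≤ (c : ℕ) ∧ (c : ℕ) < d + m then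
    - pd1 f (d + m - 1 - (c : ℕ)) (m - 1 - (r : ℕ)) x
  else if (r : ℕ) < m ∧ (c : ℕ) = d + m then
    (if h : m - 1 - (r : ℕ) < m then f x ⟨m - 1 - (r : ℕ), h⟩ else 0)
      - ∑ i : Fin d, x i * pd1 f (i : ℕ) (m - 1 - (r : ℕ)) x
  else if m ≤ (r : ℕ) ∧ (r : ℕ) < d + m ∧ (c : ℕ) = d + m then
    (if h : d + m - 1 - (r : ℕ) < d then x ⟨d + m - 1 - (r : ℕ), h⟩ else 0)
  else 0

/-- The inverse `a_{ε,t,v}⁻¹` of the diagonal matrix `a_{ε,t,v}`. -/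
def aInvMat (d m : ℕ) (ε t v : ℝ) : Matrix (Fin (d + m + 1)) (Fin (d + m + 1)) ℝ :=
  Matrix.diagonal (fun i => v * (if (i : ℕ) < m then ε⁻¹
    else if (i : ℕ) < d + m then (ε ^ m * Real.exp t) ^ ((1 : ℝ) / d)
    else (v ^ (d + m + 1) * Real.exp t)⁻¹))

/-- The set `𝔊(v,t,ε)`. -/
def Gfrak {d m : ℕ} (U : Set (Fin d → ℝ)) (f : (Fin d → ℝ) → Fin m → ℝ)
    (v t ε : ℝ) : Set (Fin d → ℝ) :=
  {x | x ∈ U ∧ v ≤ succMin 1 (aInvMat d m ε t v * u1Mat f x)}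

/-- The set `𝒩_θ(t,ε,B)`. -/
def NCal {d m : ℕ} (f : (Fin d → ℝ) → Fin m → ℝ) (θ : Fin (d + m) → ℝ)
    (t : ℕ) (ε : ℝ) (B : Set (Fin d → ℝ)) : Set (ℕ × (Fin d → ℤ) × (Fin m → ℤ)) :=
  {q | 0 < q.1 ∧
    (fun i => ((q.2.1 i : ℝ) + θ (Fin.castAdd m i)) / (q.1 : ℝ)) ∈ B ∧
    Real.exp ((t : ℝ) - 1) ≤ (q.1 : ℝ) ∧ (q.1 : ℝ) ≤ Real.exp t ∧
    ‖(fun j => (q.1 : ℝ) * f (fun i => ((q.2.1 i : ℝ) + θ (Fin.castAdd m i)) / (q.1 : ℝ)) j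
        - θ (Fin.natAdd d j) - (q.2.2 j : ℝ) : Fin m → ℝ)‖ ≤ ε}

/-- The set `Δ_θ(t,ε,B,ρ)`. -/
def DeltaCal {d m : ℕ} (f : (Fin d → ℝ) → Fin m → ℝ) (θ : Fin (d + m) → ℝ)
    (t : ℕ) (ε : ℝ) (B : Set (Fin d → ℝ)) (ρ : ℝ) : Set (Fin d → ℝ) :=
  ⋃ q ∈ NCal f θ t ε B,
    Metric.ball (fun i => ((q.2.1 i : ℝ) + θ (Fin.castAdd m i)) / (q.1 : ℝ)) ρ

/-- `φ = (ε^n e^t)^{1/(n+1)}`, `n = d+m`. -/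
def phiC (d m : ℕ) (ε t : ℝ) : ℝ := (ε ^ (d + m) * Real.exp t) ^ ((1 : ℝ) / (d + m + 1))

/-- `h = dt/(2(n+1))`. -/
def hC (d m : ℕ) (t : ℝ) : ℝ := (d : ℝ) * t / (2 * ((d : ℝ) + m + 1))

def gMat (d m : ℕ) (ε t : ℝ) : Matrix (Fin (d + m + 1)) (Fin (d + m + 1)) ℝ :=
  Matrix.diagonal (fun i => phiC d m ε t *
    (if (i : ℕ) < d + m then ε⁻¹ else Real.exp (-t)))

def bMat (d m : ℕ) (t : ℝ) : Matrix (Fin (d + m + 1)) (Fin (d + m + 1)) ℝ :=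
  Matrix.diagonal (fun i => if (i : ℕ) < m then Real.exp (hC d m t)
    else if (i : ℕ) < d + m then Real.exp (-(((m : ℝ) + 1) * t) / (2 * ((d : ℝ) + m + 1)))
    else Real.exp (hC d m t))

def dMat (d m : ℕ) (ε : ℝ) : Matrix (Fin (d + m + 1)) (Fin (d + m + 1)) ℝ :=
  Matrix.diagonal (fun i => if (i : ℕ) < m then 1
    else if (i : ℕ) < d + m then Real.sqrt ε else 1)

/-- The raw nongeneric set `𝔐₀(ε,t)`. -/
def M0frak {d m : ℕ} (U : Set (Fin d → ℝ)) (f : (Fin d → ℝ) → Fin m → ℝ)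
    (ε t : ℝ) : Set (Fin d → ℝ) :=
  {x | x ∈ U ∧ phiC d m ε t * Real.exp (hC d m t) <
    succMin (d + m + 1) (dMat d m ε * bMat d m t * gMat d m ε t * u1Mat f x)}

/-- The nongeneric (special) set `𝔐(ε,t)`. -/
def Mfrak {d m : ℕ} (U : Set (Fin d → ℝ)) (f : (Fin d → ℝ) → Fin m → ℝ)
    (ε t : ℝ) : Set (Fin d → ℝ) :=
  (⋃ x ∈ M0frak U f ε t, Metric.ball x (Real.sqrt ε * Real.exp (-t / 2))) ∩ U

/-- The inhomogeneous Diophantine exponent `λ_n^θ(x)` of `(x,x²,…,x^n)`, as a value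
in `[0,∞]`. -/
def lambdaN (n : ℕ) (θ : Fin n → ℝ) (x : ℝ) : ℝ≥0∞ :=
  sSup {lam : ℝ≥0∞ | ∃ τ : ℝ, lam = ENNReal.ofReal τ ∧
    (fun i : Fin n => x ^ ((i : ℕ) + 1)) ∈ SApprox n θ (fun q => q ^ (-τ))}

end

lemma card_quot_range {k : ℕ} (V : Matrix (Fin k) (Fin k) ℤ) (hV : V.det ≠ 0) :
    Nat.card ((Fin k → ℤ) ⧸ LinearMap.range V.mulVecLin) = V.det.natAbs := by
  have hinj : Function.Injective V.mulVecLin := by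
    rw [injective_iff_map_eq_zero]
    intro a ha
    exact Matrix.eq_zero_of_mulVec_eq_zero hV ha
  rw [← Submodule.natAbs_det_equiv _ (LinearEquiv.ofInjective V.mulVecLin hinj)]
  have : (LinearMap.range V.mulVecLin).subtype ∘ₗ AddMonoidHom.toIntLinearMap
      ((LinearEquiv.ofInjective V.mulVecLin hinj : (Fin k → ℤ) ≃ₗ[ℤ] _) :
        (Fin k → ℤ) →+ LinearMap.range V.mulVecLin) = V.mulVecLin := by
    ext; rfl
  rw [this, ← Matrix.toLin'_apply', LinearMap.det_toLin']

lemma count_coset {k : ℕ} (g : Matrix (Fin k) (Fin k) ℝ) (hg : g.det ≠ 0)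
    (V : Matrix (Fin k) (Fin k) ℤ) (hV : V.det ≠ 0) (r R : ℝ) (hr0 : 0 ≤ r) (hR0 : 0 ≤ R)
    (hr : ∀ i j, |(g * V.map (Int.cast : ℤ → ℝ)) i j| ≤ r)
    (Θ : Fin k → ℝ) (S : Finset (Fin k → ℤ))
    (hS : ∀ v ∈ S, ∀ i, |(g.mulVec (fun j => (v j : ℝ) + Θ j)) i| ≤ R)
    (hc : ∀ v ∈ S, ∀ v' ∈ S, v - v' ∈ LinearMap.range V.mulVecLin) :
    (S.card : ℝ) * (|g.det| * V.det.natAbs) ≤ (2 * (R + k * r)) ^ k := by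
  set W := g * V.map (Int.cast : ℤ → ℝ) with hW
  have hVd : (V.map (Int.cast : ℤ → ℝ)).det = (V.det : ℝ) := by
    have := (RingHom.map_det (Int.castRingHom ℝ) V)
    simpa [RingHom.mapMatrix_apply] using this.symm
  have hWd : W.det = g.det * V.det := by rw [hW, Matrix.det_mul, hVd]
  have hW0 : W.det ≠ 0 := by rw [hWd]; exact mul_ne_zero hg (by exact_mod_cast hV)
  have hWu : IsUnit W.det := hW0.isUnit
  set c : (Fin k → ℤ) → Fin k → ℝ := fun v => W⁻¹.mulVec (g.mulVec (fun j => (v j : ℝ) + Θ j)) with hcdef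
  set B : (Fin k → ℤ) → Set (Fin k → ℝ) := fun v => Set.pi univ (fun i => Ico (c v i) (c v i + 1)) with hBdef
  have hBm : ∀ v ∈ S, MeasurableSet (B v) := fun v _ => MeasurableSet.univ_pi (fun i => measurableSet_Ico)
  have hBv : ∀ v, volume (B v) = 1 := by
    intro v
    rw [hBdef]
    simp only [Real.volume_pi_Ico]
    simp
  have hdisj : Set.PairwiseDisjoint (S : Set (Fin k → ℤ)) B := by
    intro v hv v' hv' hne
    rw [Function.onFun, Set.disjoint_left]
    intro y hy hy'
    apply hne
    obtain ⟨u, hu⟩ := hc v hv v' hv'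
    have h1 : c v - c v' = fun i => (u i : ℝ) := by
      simp only [hcdef]
      rw [← Matrix.mulVec_sub, ← Matrix.mulVec_sub]
      have h2 : ((fun j => (v j : ℝ) + Θ j) - fun j => (v' j : ℝ) + Θ j) =
          (V.map (Int.cast : ℤ → ℝ)).mulVec (fun i => (u i : ℝ)) := by
        ext j
        have := congrFun hu j
        simp only [Matrix.mulVecLin_apply, Pi.sub_apply, Matrix.mulVec, dotProduct] at this
        simp only [Matrix.mulVec, dotProduct, Pi.sub_apply, Matrix.map_apply]
        have h3 : (v j : ℝ) - v' j = ((v j - v' j : ℤ) : ℝ) := by push_cast; ring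
        rw [add_sub_add_right_eq_sub, h3, ← this]; push_cast; rfl
      rw [h2, Matrix.mulVec_mulVec, Matrix.mulVec_mulVec, Matrix.mul_assoc, ← hW, Matrix.nonsing_inv_mul _ hWu, Matrix.one_mulVec]
    have hu0 : u = 0 := by
      ext i
      have h4 := congrFun h1 i
      have h5 := hy i (mem_univ _)
      have h6 := hy' i (mem_univ _)
      simp only [Pi.sub_apply] at h4
      simp only [mem_Ico] at h5 h6
      have h7 : (u i : ℝ) < 1 := by linarith
      have h8 : (-1 : ℝ) < u i := by linarith
      have h9 : u i < 1 := by exact_mod_cast h7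
      have h10 : -1 < u i := by exact_mod_cast h8
      simp only [Pi.zero_apply]; omega
    rw [hu0, map_zero] at hu
    exact (sub_eq_zero.1 hu.symm)
  set f := Matrix.toLin' W with hf
  have hfd : LinearMap.det f = W.det := LinearMap.det_toLin' W
  set K : Set (Fin k → ℝ) := Icc (fun _ => -(R + k * r)) (fun _ => R + k * r) with hK
  have hsub : (⋃ v ∈ S, B v) ⊆ f ⁻¹' K := by
    intro y hy
    simp only [mem_iUnion] at hy
    obtain ⟨v, hv, hy⟩ := hy
    have h1 : f y = g.mulVec (fun j => (v j : ℝ) + Θ j) + W.mulVec (y - c v) := by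
      rw [hf, Matrix.toLin'_apply, Matrix.mulVec_sub, hcdef]
      simp only
      rw [Matrix.mulVec_mulVec _ W, Matrix.mul_nonsing_inv _ hWu, Matrix.one_mulVec]
      simp
    have h2 : ∀ i, |f y i| ≤ R + k * r := by
      intro i
      rw [h1, Pi.add_apply]
      refine (abs_add_le _ _).trans (add_le_add (hS v hv i) ?_)
      rw [Matrix.mulVec, dotProduct]
      refine (Finset.abs_sum_le_sum_abs _ _).trans ?_
      calc _ ≤ ∑ j : Fin k, r := by
            apply Finset.sum_le_sum
            intro j _
            rw [abs_mul]
            have h5 := hy j (mem_univ _)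
            simp only [mem_Ico] at h5
            have : |(y - c v) j| ≤ 1 := by
              rw [abs_le, Pi.sub_apply]; constructor <;> linarith
            calc _ ≤ r * 1 := mul_le_mul (hr i j) this (abs_nonneg _) hr0
              _ = r := mul_one r
        _ = k * r := by simp
    rw [mem_preimage, hK, mem_Icc]
    exact ⟨fun i => (abs_le.1 (h2 i)).1, fun i => (abs_le.1 (h2 i)).2⟩
  have hmeas := measure_mono (μ := (volume : Measure (Fin k → ℝ))) hsub
  rw [measure_biUnion_finset hdisj hBm, Measure.addHaar_preimage_linearMap _ (by rw [hfd]; exact hW0),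
    hfd, hK, Real.volume_Icc_pi] at hmeas
  simp only [hBv, Finset.sum_const, nsmul_eq_mul, mul_one] at hmeas
  have hkr : 0 ≤ R + k * r := by positivity
  rw [Finset.prod_const, Finset.card_univ, Fintype.card_fin, ← ENNReal.ofReal_pow (by linarith),
    ← ENNReal.ofReal_mul (abs_nonneg _), ← ENNReal.ofReal_natCast,
    ENNReal.ofReal_le_ofReal_iff (mul_nonneg (abs_nonneg _) (pow_nonneg (by linarith) _))] at hmeas
  have h3 : |g.det| * (V.det.natAbs : ℝ) = |W.det| := by
    rw [hWd, abs_mul, Nat.cast_natAbs, Int.cast_abs]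
  rw [h3]
  have h4 : 0 < |W.det| := abs_pos.2 hW0
  rw [abs_inv, inv_mul_eq_div, le_div_iff₀ h4] at hmeas
  refine hmeas.trans (le_of_eq ?_)
  congr 1
  ring

lemma count_box {k : ℕ} (g : Matrix (Fin k) (Fin k) ℝ) (hg : g.det ≠ 0)
    (V : Matrix (Fin k) (Fin k) ℤ) (hV : V.det ≠ 0) (r R : ℝ) (hr0 : 0 ≤ r) (hR0 : 0 ≤ R)
    (hr : ∀ i j, |(g * V.map (Int.cast : ℤ → ℝ)) i j| ≤ r)
    (Θ : Fin k → ℝ) (S : Finset (Fin k → ℤ))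
    (hS : ∀ v ∈ S, ∀ i, |(g.mulVec (fun j => (v j : ℝ) + Θ j)) i| ≤ R) :
    (S.card : ℝ) * |g.det| ≤ (2 * (R + k * r)) ^ k := by
  classical
  have hN : 0 < V.det.natAbs := Int.natAbs_pos.2 hV
  have hcard := card_quot_range V hV
  have : Finite ((Fin k → ℤ) ⧸ LinearMap.range V.mulVecLin) :=
    Nat.finite_of_card_ne_zero (by rw [hcard]; exact hN.ne')
  have := Fintype.ofFinite ((Fin k → ℤ) ⧸ LinearMap.range V.mulVecLin)
  have h1 := Finset.card_eq_sum_card_fiberwise (s := S)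
    (f := fun v => (Submodule.Quotient.mk v : (Fin k → ℤ) ⧸ LinearMap.range V.mulVecLin))
    (t := Finset.univ) (fun _ _ => by simp)
  have h2 : ∀ b : (Fin k → ℤ) ⧸ LinearMap.range V.mulVecLin,
      ((S.filter (fun v => (Submodule.Quotient.mk v : (Fin k → ℤ) ⧸ LinearMap.range V.mulVecLin) = b)).card : ℝ)
        * (|g.det| * V.det.natAbs) ≤ (2 * (R + k * r)) ^ k := by
    intro b
    apply count_coset g hg V hV r R hr0 hR0 hr Θ
    · intro v hv; exact hS v (Finset.mem_filter.1 hv).1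
    · intro v hv v' hv'
      rw [← Submodule.Quotient.eq, (Finset.mem_filter.1 hv).2, (Finset.mem_filter.1 hv').2]
  have h3 : (S.card : ℝ) * (|g.det| * V.det.natAbs) ≤ V.det.natAbs * (2 * (R + k * r)) ^ k := by
    rw [h1, Nat.cast_sum, Finset.sum_mul]
    refine (Finset.sum_le_sum (fun b _ => h2 b)).trans ?_
    rw [Finset.sum_const, Finset.card_univ, ← Nat.card_eq_fintype_card, hcard, nsmul_eq_mul]
  have hN' : (0 : ℝ) < V.det.natAbs := by exact_mod_cast hN
  nlinarith [h3, hN']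

lemma exists_V {k : ℕ} (g : Matrix (Fin k) (Fin k) ℝ) (hg : g.det ≠ 0) (r : ℝ) (hr : 0 < r)
    (h : sInf {r : ℝ | 0 ≤ r ∧ k ≤ Module.finrank ℝ
    (Submodule.span ℝ {w : Fin k → ℝ | (∃ v : Fin k → ℤ, v ≠ 0 ∧
      w = g.mulVec (fun j => (v j : ℝ))) ∧ Real.sqrt (∑ j, w j ^ 2) ≤ r})} ≤ r) :
    ∃ V : Matrix (Fin k) (Fin k) ℤ, V.det ≠ 0 ∧
      ∀ i j, |(g * V.map (Int.cast : ℤ → ℝ)) i j| ≤ 2 * r := by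
  have hne : {r : ℝ | 0 ≤ r ∧ k ≤ Module.finrank ℝ
    (Submodule.span ℝ {w : Fin k → ℝ | (∃ v : Fin k → ℤ, v ≠ 0 ∧
      w = g.mulVec (fun j => (v j : ℝ))) ∧ Real.sqrt (∑ j, w j ^ 2) ≤ r})}.Nonempty := by
    refine ⟨∑ a, Real.sqrt (∑ j, g j a ^ 2), Finset.sum_nonneg (fun _ _ => Real.sqrt_nonneg _), ?_⟩
    have hli : LinearIndependent ℝ g.col := by
      apply Matrix.linearIndependent_cols_of_det_ne_zero hg
    have h1 := finrank_span_eq_card hli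
    rw [Fintype.card_fin] at h1
    refine h1.symm.le.trans ?_
    apply Submodule.finrank_mono
    apply Submodule.span_mono
    rintro _ ⟨a, rfl⟩
    refine ⟨⟨Pi.single a 1, by simp, ?_⟩, ?_⟩
    · have : (fun j => ((Pi.single a 1 : Fin k → ℤ) j : ℝ)) = Pi.single a 1 := by
        ext j; by_cases hj : j = a
        · subst hj; simp
        · simp [hj]
      rw [this, Matrix.mulVec_single_one]
    · exact Finset.single_le_sum (f := fun a => Real.sqrt (∑ j, g j a ^ 2))
        (fun _ _ => Real.sqrt_nonneg _) (Finset.mem_univ a)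
  obtain ⟨s, ⟨hs0, hsk⟩, hs⟩ := exists_lt_of_csInf_lt hne (lt_of_le_of_lt h (by linarith : r < 2 * r))
  obtain ⟨F, hF, -, hFli⟩ := Submodule.exists_fun_fin_finrank_span_eq ℝ {w : Fin k → ℝ | (∃ v : Fin k → ℤ, v ≠ 0 ∧
      w = g.mulVec (fun j => (v j : ℝ))) ∧ Real.sqrt (∑ j, w j ^ 2) ≤ s}
  set G : Fin k → Fin k → ℝ := F ∘ Fin.castLE hsk with hG
  have hGli : LinearIndependent ℝ G := hFli.comp _ (Fin.castLE_injective hsk)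
  have hGm : ∀ i, _ := fun i => hF (Fin.castLE hsk i)
  choose v hv hvs using fun i => (hGm i).1
  have hcol : ∀ i j, (g * (Matrix.of (fun i j => v j i)).map (Int.cast : ℤ → ℝ)) i j = G j i := by
    intro i j
    rw [hG, Function.comp, hvs j]
    rfl
  refine ⟨Matrix.of (fun i j => v j i), ?_, ?_⟩
  · intro h0
    have hd : (g * (Matrix.of (fun i j => v j i)).map (Int.cast : ℤ → ℝ)).det = 0 := by
      rw [Matrix.det_mul]
      have := (RingHom.map_det (Int.castRingHom ℝ) (Matrix.of (fun i j => v j i)))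
      rw [h0] at this
      simp only [RingHom.mapMatrix_apply, map_zero] at this
      have h2 : ((Matrix.of (fun i j => v j i)).map (Int.cast : ℤ → ℝ)).det = 0 := this.symm
      rw [h2, mul_zero]
    have h3 : (g * (Matrix.of (fun i j => v j i)).map (Int.cast : ℤ → ℝ)) = (Matrix.of G).transpose := by
      ext i j; rw [hcol]; rfl
    rw [h3, Matrix.det_transpose] at hd
    have h4 : IsUnit (Matrix.of G) := Matrix.linearIndependent_rows_iff_isUnit.1 hGli
    exact ((Matrix.isUnit_iff_isUnit_det _).1 h4).ne_zero hd
  · intro i j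
    rw [hcol]
    have h1 := (hGm j).2
    have h2 : |G j i| ≤ Real.sqrt (∑ l, G j l ^ 2) := by
      rw [← Real.sqrt_sq_eq_abs]
      apply Real.sqrt_le_sqrt
      exact Finset.single_le_sum (f := fun l => G j l ^ 2) (fun _ _ => sq_nonneg _) (Finset.mem_univ i)
    exact h2.trans (h1.trans hs.le)
lemma opnorm_le_coord {d : ℕ} (L : (Fin d → ℝ) →L[ℝ] ℝ) (c : ℝ) (hc : 0 ≤ c)
    (h : ∀ i, |L (Pi.single i 1)| ≤ c) : ‖L‖ ≤ d * c := by
  refine L.opNorm_le_bound (by positivity) (fun v => ?_)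
  have hv : v = ∑ i, v i • (Pi.single i 1 : Fin d → ℝ) := by
    ext j; simp [Finset.sum_apply, Pi.single_apply]
  conv_lhs => rw [hv]
  rw [map_sum]
  refine (norm_sum_le _ _).trans ?_
  calc _ ≤ ∑ i : Fin d, c * ‖v‖ := by
        apply Finset.sum_le_sum
        intro i _
        rw [map_smul, norm_smul, mul_comm]
        exact mul_le_mul (h i) (norm_le_pi_norm v i) (norm_nonneg _) hc
    _ = d * c * ‖v‖ := by simp; ring

lemma taylor_bound {d m : ℕ} (U : Set (Fin d → ℝ)) (hU : IsOpen U)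
    (f : (Fin d → ℝ) → Fin m → ℝ) (hf : ContDiffOn ℝ 2 f U)
    (M : ℝ) (hM : 1 ≤ M)
    (hM2 : ∀ x ∈ U, ∀ i i' j : ℕ, |pd2 f i i' j x| ≤ M)
    (z : Fin d → ℝ) (rB : ℝ) (hB : Metric.ball z rB ⊆ U)
    (x x₀ : Fin d → ℝ) (hx : x ∈ Metric.ball z rB) (hx₀ : x₀ ∈ Metric.ball z rB) (j : Fin m) :
    |f x j - f x₀ j - ∑ i : Fin d, pd1 f i j x₀ * (x i - x₀ i)| ≤ d ^ 2 * M * ‖x - x₀‖ ^ 2 := by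
  have hfj : ContDiffOn ℝ 2 (fun y => f y j) U := by
    exact (contDiffOn_pi.1 hf) j
  have hdiff : ∀ y ∈ U, DifferentiableAt ℝ (fun y => f y j) y := fun y hy =>
    (hfj.differentiableOn (by norm_num)).differentiableAt (hU.mem_nhds hy)
  have hfd : ContDiffOn ℝ 1 (fderiv ℝ (fun y => f y j)) U :=
    hfj.fderiv_of_isOpen hU (by norm_num)
  have hpd : ∀ i : Fin d, ∀ y, pd1 f i j y = fderiv ℝ (fun y => f y j) y (Pi.single i 1) := by
    intro i y
    rw [pd1, dif_pos ⟨i.2, j.2⟩]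
  have hpd' : ∀ i : Fin d, ∀ y ∈ U, DifferentiableAt ℝ (fun y => pd1 f i j y) y := by
    intro i y hy
    simp only [hpd]
    exact ((hfd.differentiableOn (by norm_num)).differentiableAt (hU.mem_nhds hy)).clm_apply
      (differentiableAt_const _)
  have hpdn : ∀ i : Fin d, ∀ y ∈ U, ‖fderiv ℝ (fun y => pd1 f i j y) y‖ ≤ d * M := by
    intro i y hy
    apply opnorm_le_coord _ _ (by linarith)
    intro i'
    have := hM2 y hy i i' j
    rwa [pd2, dif_pos i'.2] at this
  have hlip : ∀ i : Fin d, ∀ y ∈ Metric.ball z rB, |pd1 f i j y - pd1 f i j x₀| ≤ d * M * ‖y - x₀‖ := by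
    intro i y hy
    exact (convex_ball z rB).norm_image_sub_le_of_norm_fderiv_le (𝕜 := ℝ)
      (fun y hy => hpd' i y (hB hy)) (fun y hy => hpdn i y (hB hy)) hx₀ hy
  set φ := fderiv ℝ (fun y => f y j) x₀ with hφ
  have hconv : Convex ℝ (Metric.closedBall x₀ ‖x - x₀‖ ∩ Metric.ball z rB) :=
    (convex_closedBall _ _).inter (convex_ball _ _)
  have h1 := hconv.norm_image_sub_le_of_norm_fderiv_le' (𝕜 := ℝ) (f := fun y => f y j) (φ := φ)
    (C := d * (d * M * ‖x - x₀‖)) (x := x₀) (y := x)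
    (fun y hy => hdiff y (hB hy.2)) (fun y hy => by
      apply opnorm_le_coord _ _ (by positivity)
      intro i
      have h2 := hlip i y hy.2
      rw [hpd, hpd] at h2
      refine h2.trans ?_
      have h3 : ‖y - x₀‖ ≤ ‖x - x₀‖ := by
        have := hy.1; rwa [Metric.mem_closedBall, dist_eq_norm] at this
      exact mul_le_mul_of_nonneg_left h3 (by positivity))
    ⟨Metric.mem_closedBall_self (norm_nonneg _), hx₀⟩
    ⟨by rw [Metric.mem_closedBall, dist_eq_norm], hx⟩
  have h4 : φ (x - x₀) = ∑ i : Fin d, pd1 f i j x₀ * (x i - x₀ i) := by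
    have hv : x - x₀ = ∑ i, (x - x₀) i • (Pi.single i 1 : Fin d → ℝ) := by
      ext j; simp [Finset.sum_apply, Pi.single_apply]
    conv_lhs => rw [hv]
    rw [map_sum]
    apply Finset.sum_congr rfl
    intro i _
    rw [map_smul, hpd, smul_eq_mul, mul_comm]; rfl
  rw [h4, Real.norm_eq_abs] at h1
  refine h1.trans (le_of_eq ?_)
  ring

/-- The vector `(-P_n, …, -P_1, q)`. -/
def wVec {d m : ℕ} {α : Type*} [Neg α] (P : Fin (d + m) → α) (q : α) : Fin (d + m + 1) → α :=
  Fin.snoc (α := fun _ => α) (fun r => - P r.rev) q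

lemma u1_sum {d m : ℕ} (f : (Fin d → ℝ) → Fin m → ℝ) (x : Fin d → ℝ) (P : Fin (d + m) → ℝ) (q : ℝ)
    (r : Fin (d + m + 1)) :
    (u1Mat f x).mulVec (wVec P q) r =
      ∑ i : Fin d, u1Mat f x r (Fin.castAdd m i).rev.castSucc * (- P (Fin.castAdd m i)) +
      ∑ j : Fin m, u1Mat f x r (Fin.natAdd d j).rev.castSucc * (- P (Fin.natAdd d j)) +
      u1Mat f x r (Fin.last _) * q := by
  rw [Matrix.mulVec, dotProduct, Fin.sum_univ_castSucc]
  congr 1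
  · rw [← Fin.sum_univ_add (fun c : Fin (d + m) => u1Mat f x r c.rev.castSucc * (- P c)),
      ← Equiv.sum_comp Fin.revPerm]
    apply Finset.sum_congr rfl
    intro c _
    simp [wVec, Fin.snoc_castSucc]
  · simp [wVec]

lemma u1_row_last {d m : ℕ} (f : (Fin d → ℝ) → Fin m → ℝ) (x : Fin d → ℝ) (P : Fin (d + m) → ℝ) (q : ℝ) :
    (u1Mat f x).mulVec (wVec P q) (Fin.last _) = q := by
  rw [u1_sum]
  have h1 : ∀ c : Fin (d + m), u1Mat f x (Fin.last _) c.castSucc = 0 := by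
    intro c
    have := c.2
    simp only [u1Mat, Fin.val_last, Fin.val_castSucc]
    rw [if_neg (by omega), if_neg (by omega), if_neg (by omega), if_neg (by omega)]
  simp only [h1]
  simp [u1Mat]

lemma u1_row_i {d m : ℕ} (f : (Fin d → ℝ) → Fin m → ℝ) (x : Fin d → ℝ) (P : Fin (d + m) → ℝ) (q : ℝ)
    (i : Fin d) :
    (u1Mat f x).mulVec (wVec P q) (Fin.castAdd m i).rev.castSucc = q * x i - P (Fin.castAdd m i) := by
  rw [u1_sum]
  have hi := i.2
  have h1 : ∀ c : Fin d, u1Mat f x (Fin.castAdd m i).rev.castSucc (Fin.castAdd m c).rev.castSucc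
      = if c = i then 1 else 0 := by
    intro c
    have := c.2
    simp only [u1Mat, Fin.val_castSucc, Fin.val_rev, Fin.val_castAdd]
    by_cases h : c = i
    · subst h; simp
    · have h' : (c : ℕ) ≠ i := fun h2 => h (Fin.ext h2)
      rw [if_neg (by omega), if_neg (by omega), if_neg (by omega), if_neg (by omega), if_neg h]
  have h2 : ∀ c : Fin m, u1Mat f x (Fin.castAdd m i).rev.castSucc (Fin.natAdd d c).rev.castSucc
      = 0 := by
    intro c
    have := c.2
    simp only [u1Mat, Fin.val_castSucc, Fin.val_rev, Fin.val_castAdd, Fin.val_natAdd]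
    rw [if_neg (by omega), if_neg (by omega), if_neg (by omega), if_neg (by omega)]
  have h3 : u1Mat f x (Fin.castAdd m i).rev.castSucc (Fin.last _) = x i := by
    simp only [u1Mat, Fin.val_castSucc, Fin.val_rev, Fin.val_castAdd, Fin.val_last]
    rw [if_neg (by omega), if_neg (by omega), if_neg (by omega), if_pos ⟨by omega, by omega, by trivial⟩, dif_pos (by omega)]
    congr 1; apply Fin.ext; simp only; omega
  simp only [h1, h2, h3]
  simp; ring

lemma u1_row_j {d m : ℕ} (f : (Fin d → ℝ) → Fin m → ℝ) (x : Fin d → ℝ) (P : Fin (d + m) → ℝ) (q : ℝ)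
    (j : Fin m) :
    (u1Mat f x).mulVec (wVec P q) (Fin.natAdd d j).rev.castSucc =
      q * f x j - P (Fin.natAdd d j) - ∑ i : Fin d, pd1 f i j x * (q * x i - P (Fin.castAdd m i)) := by
  rw [u1_sum]
  have hj := j.2
  have h1 : ∀ c : Fin d, u1Mat f x (Fin.natAdd d j).rev.castSucc (Fin.castAdd m c).rev.castSucc
      = - pd1 f c j x := by
    intro c
    have := c.2
    simp only [u1Mat, Fin.val_castSucc, Fin.val_rev, Fin.val_castAdd, Fin.val_natAdd]
    rw [if_neg (by omega), if_pos (by omega)]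
    congr 2 <;> omega
  have h2 : ∀ c : Fin m, u1Mat f x (Fin.natAdd d j).rev.castSucc (Fin.natAdd d c).rev.castSucc
      = if c = j then 1 else 0 := by
    intro c
    have := c.2
    simp only [u1Mat, Fin.val_castSucc, Fin.val_rev, Fin.val_natAdd]
    by_cases h : c = j
    · subst h; simp
    · have h' : (c : ℕ) ≠ j := fun h2 => h (Fin.ext h2)
      rw [if_neg (by omega), if_neg (by omega), if_neg (by omega), if_neg (by omega), if_neg h]
  have h3 : u1Mat f x (Fin.natAdd d j).rev.castSucc (Fin.last _)
      = f x j - ∑ i : Fin d, x i * pd1 f i j x := by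
    simp only [u1Mat, Fin.val_castSucc, Fin.val_rev, Fin.val_natAdd, Fin.val_last]
    have e : m - 1 - (d + m - (d + (j : ℕ) + 1)) = j := by omega
    rw [if_neg (by omega), if_neg (by omega), if_pos ⟨by omega, by trivial⟩, dif_pos (by omega)]
    simp only [e]
  simp only [h1, h2, h3]
  have h4 : ∑ i : Fin d, pd1 f i j x * (q * x i - P (Fin.castAdd m i)) =
      (∑ i : Fin d, x i * pd1 f i j x) * q - ∑ i : Fin d, -pd1 f i j x * -P (Fin.castAdd m i) := by
    rw [Finset.sum_mul, ← Finset.sum_sub_distrib]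
    apply Finset.sum_congr rfl
    intro i _; ring
  rw [h4]
  simp only [ite_mul, one_mul, zero_mul, Finset.sum_ite_eq', Finset.mem_univ, if_true]
  ring

lemma u1_det {d m : ℕ} (f : (Fin d → ℝ) → Fin m → ℝ) (x : Fin d → ℝ) : (u1Mat f x).det = 1 := by
  rw [Matrix.det_of_isUpperTriangular]
  · apply Finset.prod_eq_one
    intro i _
    simp [u1Mat]
  · intro r c h
    have h' : (c : ℕ) < r := h
    have := r.2
    simp only [u1Mat]
    rw [if_neg (by omega), if_neg (by omega), if_neg (by omega), if_neg (by omega)]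

/-- diagonal entries -/
noncomputable def dgD (d m : ℕ) (ε t : ℝ) (r : Fin (d + m + 1)) : ℝ :=
  phiC d m ε t * Real.exp (hC d m t) *
    (if (r : ℕ) < m then ε⁻¹ else if (r : ℕ) < d + m then (Real.sqrt ε * Real.exp (t / 2))⁻¹ else
      (Real.exp (t / 2) ^ 2)⁻¹)

lemma exp_half_sq (t : ℝ) : Real.exp (t / 2) ^ 2 = Real.exp t := by
  rw [← Real.exp_nat_mul]; congr 1; push_cast; ring

lemma mat_eq (d m : ℕ) (ε t : ℝ) (hε : 0 < ε) :
    dMat d m ε * bMat d m t * gMat d m ε t = Matrix.diagonal (dgD d m ε t) := by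
  rw [dMat, bMat, gMat, Matrix.diagonal_mul_diagonal, Matrix.diagonal_mul_diagonal]
  congr 1
  ext r
  rw [dgD]
  by_cases h1 : (r : ℕ) < m
  · have h2 : (r : ℕ) < d + m := by omega
    simp only [h1, h2, if_true]; ring
  · by_cases h2 : (r : ℕ) < d + m
    · simp only [h1, h2, if_true, if_false]
      have e1 : Real.exp (-(((m : ℝ) + 1) * t) / (2 * ((d : ℝ) + m + 1))) =
          Real.exp (hC d m t) * (Real.exp (t / 2))⁻¹ := by
        rw [← Real.exp_neg, ← Real.exp_add, hC]
        congr 1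
        have : (d : ℝ) + m + 1 ≠ 0 := by positivity
        field_simp
        ring
      rw [e1]
      have hs : 0 < Real.sqrt ε := Real.sqrt_pos.2 hε
      have e2 : ε⁻¹ = (Real.sqrt ε)⁻¹ * (Real.sqrt ε)⁻¹ := by
        rw [← mul_inv, Real.mul_self_sqrt hε.le]
      rw [e2, mul_inv]
      field_simp
    · simp only [h1, h2, if_false]
      rw [exp_half_sq, Real.exp_neg]; ring

lemma prod_dgD (d m : ℕ) (ε t : ℝ) :
    ∏ r, dgD d m ε t r = (phiC d m ε t * Real.exp (hC d m t)) ^ (d + m + 1) *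
      (((Real.sqrt ε * Real.exp (t / 2))⁻¹) ^ d * (ε⁻¹) ^ m * (Real.exp (t / 2) ^ 2)⁻¹) := by
  simp only [dgD]
  rw [Finset.prod_mul_distrib, Finset.prod_const, Finset.card_univ, Fintype.card_fin]
  congr 1
  rw [Fin.prod_univ_castSucc, ← Equiv.prod_comp Fin.revPerm, Fin.prod_univ_add]
  congr 1
  · congr 1
    · rw [Finset.prod_congr rfl (g := fun _ => (Real.sqrt ε * Real.exp (t / 2))⁻¹)]
      · simp
      · intro i _
        have := i.2
        simp only [Fin.revPerm_apply, Fin.val_castSucc, Fin.val_rev, Fin.val_castAdd]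
        rw [if_neg (by omega), if_pos (by omega)]
    · rw [Finset.prod_congr rfl (g := fun _ => ε⁻¹)]
      · simp
      · intro i _
        have := i.2
        simp only [Fin.revPerm_apply, Fin.val_castSucc, Fin.val_rev, Fin.val_natAdd]
        rw [if_pos (by omega)]
  · simp only [Fin.val_last]
    rw [if_neg (by omega), if_neg (by omega)]

lemma wVec_injective {d m : ℕ} :
    Function.Injective (fun pq : (Fin (d + m) → ℤ) × ℤ => wVec pq.1 pq.2) := by
  rintro ⟨p, q⟩ ⟨p', q'⟩ h
  simp only at h
  have hq : q = q' := by
    have := congrFun h (Fin.last _)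
    simpa [wVec] using this
  have hp : p = p' := by
    ext i
    have := congrFun h i.rev.castSucc
    simpa [wVec, Fin.snoc_castSucc] using this
  rw [hp, hq]

lemma wVec_cast {d m : ℕ} (p : Fin (d + m) → ℤ) (q : ℤ) (θ : Fin (d + m) → ℝ) :
    (fun r => ((wVec p q r : ℤ) : ℝ) + wVec θ 0 r) = wVec (fun i => (p i : ℝ) + θ i) (q : ℝ) := by
  ext r
  refine Fin.lastCases ?_ (fun c => ?_) r
  · simp [wVec]
  · simp [wVec, Fin.snoc_castSucc]; ring

/-- Bounds for the coordinates of a counted point. -/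
lemma row_bounds {d m : ℕ} (U : Set (Fin d → ℝ)) (hU : IsOpen U)
    (f : (Fin d → ℝ) → Fin m → ℝ) (hf : ContDiffOn ℝ 2 f U)
    (M : ℝ) (hM : 1 ≤ M)
    (hM1 : ∀ x ∈ U, ∀ i j : ℕ, |pd1 f i j x| ≤ M)
    (hM2 : ∀ x ∈ U, ∀ i i' j : ℕ, |pd2 f i i' j x| ≤ M)
    (z : Fin d → ℝ) (rB : ℝ) (hB : Metric.ball z rB ⊆ U)
    (s τ : ℝ) (hs : 0 < s) (hτ : 0 < τ) (hsτ : s ≤ τ)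
    (x x₀ : Fin d → ℝ) (hx : x ∈ Metric.ball z rB) (hx₀ : x₀ ∈ Metric.ball z rB)
    (hxx : ‖x - x₀‖ ≤ s / τ) (P : Fin (d + m) → ℝ) (q : ℝ) (hq0 : 0 ≤ q) (hq : q ≤ τ ^ 2)
    (hP : ∀ i, |q * fullMap d m f x i - P i| ≤ 2 * s ^ 2) :
    (∀ i : Fin d, |q * x₀ i - P (Fin.castAdd m i)| ≤ 3 * (s * τ)) ∧
    (∀ j : Fin m, |q * f x₀ j - P (Fin.natAdd d j) -
      ∑ i : Fin d, pd1 f i j x₀ * (q * x₀ i - P (Fin.castAdd m i))| ≤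
        (2 + d ^ 2 * M + 2 * d * M) * s ^ 2) := by
  have hPi : ∀ i : Fin d, |q * x i - P (Fin.castAdd m i)| ≤ 2 * s ^ 2 := by
    intro i
    have := hP (Fin.castAdd m i)
    simpa [fullMap] using this
  have hPj : ∀ j : Fin m, |q * f x j - P (Fin.natAdd d j)| ≤ 2 * s ^ 2 := by
    intro j
    have := hP (Fin.natAdd d j)
    simpa [fullMap] using this
  have hst : τ ^ 2 * (s / τ) = s * τ := by field_simp
  constructor
  · intro i
    have h1 : |x i - x₀ i| ≤ s / τ := (norm_le_pi_norm (x - x₀) i).trans hxx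
    have h2 : |q * (x i - x₀ i)| ≤ s * τ := by
      rw [abs_mul, abs_of_nonneg hq0, ← hst]
      exact mul_le_mul hq h1 (abs_nonneg _) (by positivity)
    have h3 : q * x₀ i - P (Fin.castAdd m i) = (q * x i - P (Fin.castAdd m i)) - q * (x i - x₀ i) := by
      ring
    rw [h3]
    refine (abs_sub _ _).trans ?_
    have := hPi i
    nlinarith
  · intro j
    have hT := taylor_bound U hU f hf M hM hM2 z rB hB x x₀ hx hx₀ j
    set A := f x j - f x₀ j - ∑ i : Fin d, pd1 f i j x₀ * (x i - x₀ i) with hA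
    have h1 : q * f x₀ j - P (Fin.natAdd d j) -
      ∑ i : Fin d, pd1 f i j x₀ * (q * x₀ i - P (Fin.castAdd m i)) =
      (q * f x j - P (Fin.natAdd d j)) - q * A -
        ∑ i : Fin d, pd1 f i j x₀ * (q * x i - P (Fin.castAdd m i)) := by
      have : ∑ i : Fin d, pd1 f i j x₀ * (q * x i - P (Fin.castAdd m i)) =
        ∑ i : Fin d, pd1 f i j x₀ * (q * x₀ i - P (Fin.castAdd m i)) +
          q * ∑ i : Fin d, pd1 f i j x₀ * (x i - x₀ i) := by
        rw [Finset.mul_sum, ← Finset.sum_add_distrib]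
        apply Finset.sum_congr rfl
        intro i _; ring
      rw [this, hA]; ring
    have h2 : |q * A| ≤ d ^ 2 * M * s ^ 2 := by
      rw [abs_mul, abs_of_nonneg hq0]
      have h3 : |A| ≤ d ^ 2 * M * (s / τ) ^ 2 := by
        refine hT.trans ?_
        gcongr
      calc q * |A| ≤ τ ^ 2 * (d ^ 2 * M * (s / τ) ^ 2) :=
            mul_le_mul hq h3 (abs_nonneg _) (by positivity)
        _ = _ := by field_simp
    have h4 : |∑ i : Fin d, pd1 f i j x₀ * (q * x i - P (Fin.castAdd m i))| ≤ 2 * d * M * s ^ 2 := by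
      refine (Finset.abs_sum_le_sum_abs _ _).trans ?_
      calc _ ≤ ∑ i : Fin d, M * (2 * s ^ 2) := by
            apply Finset.sum_le_sum
            intro i _
            rw [abs_mul]
            exact mul_le_mul (hM1 x₀ (hB hx₀) i j) (hPi i) (abs_nonneg _) (by linarith)
        _ = _ := by simp; ring
    rw [h1]
    refine (abs_sub _ _).trans ?_
    have h5 := abs_sub (q * f x j - P (Fin.natAdd d j)) (q * A)
    have := hPj j
    linarith

/-- **Counting on small balls in the generic part** (Lemma 6.6). -/
theorem generic_small_ball_count
    {d m : ℕ} (hd : 0 < d) (hm : 0 < m)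
    (U : Set (Fin d → ℝ)) (hU : IsOpen U)
    (f : (Fin d → ℝ) → Fin m → ℝ) (hf : ContDiffOn ℝ 2 f U)
    (M : ℝ) (hM : 1 ≤ M)
    (hM1 : ∀ x ∈ U, ∀ i j : ℕ, |pd1 f i j x| ≤ M)
    (hM2 : ∀ x ∈ U, ∀ i i' j : ℕ, |pd2 f i i' j x| ≤ M)
    (θ : Fin (d + m) → ℝ)
    (z : Fin d → ℝ) (rB : ℝ) (hrB : 0 < rB) (hB : Metric.ball z rB ⊆ U) :
    ∃ C : ℝ, 0 < C ∧ ∃ t₀ : ℝ, ∀ t : ℝ, t₀ ≤ t → ∀ ε : ℝ, 0 < ε → ε < 1 →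
      ∀ x₀ ∈ Metric.ball z rB ∩ (U \ Mfrak U f ε t),
        (Nfull (fullMap d m f) θ
            (Metric.closedBall x₀ (Real.sqrt (ε / Real.exp t)) ∩ Metric.ball z rB)
            ε t : ℝ) ≤
          C * ε ^ (d + m) * Real.exp t * (ε * Real.exp (-t)) ^ (-((d : ℝ) / 2)) := by
  classical
  set K : ℝ := 3 + d ^ 2 * M + 2 * d * M with hK
  have hK0 : 0 < K := by positivity
  set k := d + m + 1 with hk
  refine ⟨(2 * (K + k * 2)) ^ k, by positivity, 0, ?_⟩
  intro t ht ε hε hε1 x₀ hx₀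
  obtain ⟨hx₀B, hx₀U, hx₀M⟩ := hx₀
  set s := Real.sqrt ε with hsdef
  set τ := Real.exp (t / 2) with hτdef
  have hs : 0 < s := Real.sqrt_pos.2 hε
  have hτ : 0 < τ := Real.exp_pos _
  have hs2 : s ^ 2 = ε := Real.sq_sqrt hε.le
  have hτ2 : τ ^ 2 = Real.exp t := exp_half_sq t
  have hs1 : s ≤ 1 := by
    nlinarith
  have hτ1 : 1 ≤ τ := Real.one_le_exp (by linarith)
  set a := phiC d m ε t * Real.exp (hC d m t) with ha
  have ha0 : 0 < a := by
    rw [ha, phiC]; positivity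
  set g := dMat d m ε * bMat d m t * gMat d m ε t * u1Mat f x₀ with hg
  have hgD : g = Matrix.diagonal (dgD d m ε t) * u1Mat f x₀ := by rw [hg, mat_eq d m ε t hε]
  have hdet : g.det = a ^ k * (((s * τ)⁻¹) ^ d * (ε⁻¹) ^ m * (τ ^ 2)⁻¹) := by
    rw [hgD, Matrix.det_mul, u1_det, mul_one, Matrix.det_diagonal, prod_dgD]
  have hdet0 : 0 < g.det := by rw [hdet]; positivity
  have hsm : succMin (d + m + 1) g ≤ a := by
    by_contra hcon
    push Not at hcon
    apply hx₀M
    refine ⟨?_, hx₀U⟩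
    simp only [mem_iUnion]
    exact ⟨x₀, ⟨hx₀U, hcon⟩, Metric.mem_ball_self (by positivity)⟩
  obtain ⟨V, hV, hVr⟩ := exists_V g hdet0.ne' a ha0 hsm
  set Δ := Metric.closedBall x₀ (Real.sqrt (ε / Real.exp t)) ∩ Metric.ball z rB with hΔ
  have hrad : Real.sqrt (ε / Real.exp t) = s / τ := by
    rw [← hs2, ← hτ2, ← div_pow, Real.sqrt_sq (by positivity)]
  have hx₀Δ : x₀ ∈ Δ := ⟨Metric.mem_closedBall_self (Real.sqrt_nonneg _), hx₀B⟩
  have hRHS : ε ^ (d + m) * Real.exp t * (ε * Real.exp (-t)) ^ (-((d : ℝ) / 2)) =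
      (((s * τ)⁻¹) ^ d * (ε⁻¹) ^ m * (τ ^ 2)⁻¹)⁻¹ := by
    have e1 : ε * Real.exp (-t) = (s / τ) ^ (2 : ℝ) := by
      rw [Real.exp_neg, ← hτ2, ← hs2, Real.rpow_two, div_pow]; rfl
    rw [e1, ← Real.rpow_mul (by positivity), ← hτ2, ← hs2]
    have e2 : (2 : ℝ) * -((d : ℝ) / 2) = -(d : ℝ) := by ring
    rw [e2, Real.rpow_neg (by positivity), Real.rpow_natCast, div_pow, inv_pow, inv_pow, mul_pow, pow_add, ← pow_mul, ← pow_mul]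
    have e3 : s ^ (2 * d) = s ^ d * s ^ d := by rw [← pow_add]; congr 1; ring
    rw [e3]
    field_simp
  by_cases hfin : (NfullSet (fullMap d m f) θ Δ ε t).Finite
  swap
  · rw [Nfull, Set.Infinite.ncard hfin]
    simp only [Nat.cast_zero]
    positivity
  rw [Nfull, Set.ncard_eq_toFinset_card _ hfin]
  set S := hfin.toFinset.image (fun pq : (Fin (d + m) → ℤ) × ℤ => wVec pq.1 pq.2) with hS
  have hScard : S.card = hfin.toFinset.card := Finset.card_image_of_injective _ wVec_injective
  rw [← hScard]
  have hbound := count_box g hdet0.ne' V hV (2 * a) (K * a) (by positivity) (by positivity) hVr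
    (wVec θ 0) S (by
      intro v hv r
      rw [hS, Finset.mem_image] at hv
      obtain ⟨⟨p, q⟩, hpq, rfl⟩ := hv
      rw [Set.Finite.mem_toFinset] at hpq
      obtain ⟨hq1, hq2, hinf⟩ := hpq
      simp only at hq1 hq2 hinf
      have hq1' : (1 : ℝ) ≤ q := by exact_mod_cast hq1
      have hεt : ε / Real.exp t < 2 * (ε / Real.exp t) := by
        have : 0 < ε / Real.exp t := by positivity
        linarith
      obtain ⟨_, ⟨x, hxΔ, rfl⟩, hxlt⟩ := exists_lt_of_csInf_lt (Set.Nonempty.image _ ⟨x₀, hx₀Δ⟩)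
        (lt_of_le_of_lt hinf hεt)
      simp only at hxlt
      simp only
      rw [wVec_cast]
      set P : Fin (d + m) → ℝ := fun i => (p i : ℝ) + θ i with hP
      have hPb : ∀ i, |(q : ℝ) * fullMap d m f x i - P i| ≤ 2 * s ^ 2 := by
        intro i
        have h1 := (norm_le_pi_norm (fun i => fullMap d m f x i - ((p i : ℝ) + θ i) / (q : ℝ)) i).trans hxlt.le
        rw [Real.norm_eq_abs] at h1
        have hq0 : (0 : ℝ) < q := by linarith
        have h2 : (q : ℝ) * fullMap d m f x i - P i =
            q * (fullMap d m f x i - ((p i : ℝ) + θ i) / (q : ℝ)) := by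
          rw [hP]; field_simp
        rw [h2, abs_mul, abs_of_pos hq0, hs2]
        calc _ ≤ Real.exp t * (2 * (ε / Real.exp t)) :=
              mul_le_mul hq2 h1 (abs_nonneg _) (Real.exp_pos _).le
          _ = 2 * ε := by field_simp
      have hxx : ‖x - x₀‖ ≤ s / τ := by
        have := hxΔ.1
        rwa [Metric.mem_closedBall, dist_eq_norm, hrad] at this
      obtain ⟨hri, hrj⟩ := row_bounds U hU f hf M hM hM1 hM2 z rB hB s τ hs hτ (hs1.trans hτ1)
        x x₀ hxΔ.2 hx₀B hxx P q (by linarith) (by rw [hτ2]; exact hq2) hPb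
      rw [hgD, ← Matrix.mulVec_mulVec, Matrix.mulVec_diagonal, abs_mul]
      have hd2 : (0 : ℝ) ≤ d ^ 2 * M := by positivity
      have hd1 : (0 : ℝ) ≤ 2 * d * M := by positivity
      refine Fin.lastCases ?_ (fun c => ?_) r
      · rw [u1_row_last, dgD]
        simp only [Fin.val_last]
        rw [if_neg (by omega), if_neg (by omega), ← hτdef, ← ha, abs_of_pos (by positivity),
          abs_of_pos (by linarith)]
        calc a * (τ ^ 2)⁻¹ * q ≤ a * (τ ^ 2)⁻¹ * τ ^ 2 := by
              rw [← hτ2] at hq2; gcongr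
          _ = 1 * a := by field_simp
          _ ≤ K * a := by
              apply mul_le_mul_of_nonneg_right _ ha0.le
              rw [hK]; linarith
      · obtain ⟨c, rfl⟩ := Fin.rev_surjective c
        refine Fin.addCases (fun i => ?_) (fun j => ?_) c
        · have := i.2
          rw [u1_row_i, dgD]
          simp only [Fin.val_castSucc, Fin.val_rev, Fin.val_castAdd]
          rw [if_neg (by omega), if_pos (by omega), ← hτdef, ← ha, ← hsdef, abs_of_pos (by positivity)]
          calc _ ≤ a * (s * τ)⁻¹ * (3 * (s * τ)) := by
                apply mul_le_mul_of_nonneg_left (hri i) (by positivity)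
            _ = 3 * a := by field_simp
            _ ≤ K * a := by
                apply mul_le_mul_of_nonneg_right _ ha0.le
                rw [hK]; linarith
        · have := j.2
          rw [u1_row_j, dgD]
          simp only [Fin.val_castSucc, Fin.val_rev, Fin.val_natAdd]
          rw [if_pos (by omega), ← ha, ← hs2, abs_of_pos (by positivity)]
          calc _ ≤ a * (s ^ 2)⁻¹ * ((2 + d ^ 2 * M + 2 * d * M) * s ^ 2) := by
                apply mul_le_mul_of_nonneg_left (hrj j) (by positivity)
            _ = (2 + d ^ 2 * M + 2 * d * M) * a := by field_simp
            _ ≤ K * a := by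
                apply mul_le_mul_of_nonneg_right _ ha0.le
                rw [hK]; linarith)
  rw [abs_of_pos hdet0, hdet] at hbound
  have e3 : (2 * (K * a + ((d + m + 1 : ℕ) : ℝ) * (2 * a))) ^ (d + m + 1) =
      a ^ k * (2 * (K + k * 2)) ^ k := by
    rw [← mul_pow]; congr 1; ring
  rw [e3] at hbound
  have hak : 0 < a ^ k := by positivity
  rw [mul_assoc, mul_assoc, ← mul_assoc (ε ^ (d + m)), hRHS]
  set Q := ((s * τ)⁻¹) ^ d * (ε⁻¹) ^ m * (τ ^ 2)⁻¹ with hQ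
  have hQ0 : 0 < Q := by positivity
  rw [← div_eq_mul_inv, le_div_iff₀ hQ0]
  refine le_of_mul_le_mul_left ?_ hak
  linarith
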